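/- For integers m, n ≥ 1, the number of spherical K_{m+1,n}-parking functions is given by the signed sum |sPF(K_{m+1,n})| = Σ_{i=1}^{m+n} (−1)^{m+n−i} Σ_{(s,t) ∈ Γ_i} [m!/(s_1!(s_2−s_1)!⋯(s_i−s_{i−1})!)] · [n!/(t_1!(t_2−t_1)!⋯(t_i−t_{i−1})!)] · μ(s,t), where Γ_i is the set of pairs of i-tuples s = (s_1,…,s_i), t = (t_1,…,t_i) of natural numbers such that (with s_0 = t_0 = 0) s_1 ≤ s_2 ≤ … ≤ s_i = m, t_1 ≤ t_2 ≤ … ≤ t_i = n, and s_{j−1} + t_{j−1} < s_j + t_j for all 1 ≤ j ≤ i, and where μ(s,t) = ∏_{j ∈ [i], s_j < m and t_j < n} (n − t_j)^{s_j − s_{j−1}} (m − s_j)^{t_j − t_{j−1}}. -/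

import Mathlib

/-- `dA a A i` is the number of edges from the non-root vertex `i+1` to vertices outside
`A` in the multigraph on `{0,1,…,N}` with adjacency matrix `a`. -/
def dA {N : ℕ} (a : Fin (N + 1) → Fin (N + 1) → ℕ) (A : Finset (Fin N)) (i : Fin N) : ℕ :=
  a i.succ 0 + ∑ j ∈ Aᶜ, a i.succ j.succ

/-- The set of spherical `G`-parking functions of the multigraph on `{0,…,N}` with
adjacency matrix `a`. -/
def sPF {N : ℕ} (a : Fin (N + 1) → Fin (N + 1) → ℕ) : Set (Fin N → ℕ) :=
  {P | (∀ i, dA a Finset.univ i ≤ P i) ∧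
    ∀ A : Finset (Fin N), A.Nonempty → A ≠ Finset.univ → ∃ i ∈ A, P i < dA a A i}

/-- Adjacency matrix of the complete bipartite graph `K_{m+1,n}` on
`{0,1,…,m} ∪ {m+1,…,m+n}` with root `0`. -/
def Kbip (m n : ℕ) : Fin (m + n + 1) → Fin (m + n + 1) → ℕ := fun i j =>
  if i = j then 0
  else if i = 0 then (if m + 1 ≤ (j : ℕ) then 1 else 0)
  else if j = 0 then (if m + 1 ≤ (i : ℕ) then 1 else 0)
  else if ((i : ℕ) ≤ m ∧ m + 1 ≤ (j : ℕ)) ∨ ((j : ℕ) ≤ m ∧ m + 1 ≤ (i : ℕ)) then 1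
  else 0

open Finset

section Burning

variable {V : Type*} (c : V → Bool)

/-- The number of vertices of `A` whose colour differs from that of `i`, i.e. the number of
neighbours of `i` in `A` in the complete bipartite graph with colour classes given by `c`. -/
def oppCount (i : V) (A : Finset V) : ℕ := #{j ∈ A | c j ≠ c i}

/-- `W` contains vertices of both colours. -/
def TwoSided (W : Finset V) : Prop := ∀ b, ∃ i ∈ W, c i = b

variable {c} in
lemma oppCount_mono (i : V) {A B : Finset V} (h : A ⊆ B) : oppCount c i A ≤ oppCount c i B :=
  card_le_card (filter_subset_filter _ h)

variable {c} in
lemma oppCount_congr {i j : V} (h : c i = c j) (A : Finset V) :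
    oppCount c i A = oppCount c j A := by
  simp [oppCount, h]

variable {c} in
lemma oppCount_le_card [Fintype V] (i : V) (A : Finset V) : oppCount c i A ≤ Fintype.card V :=
  card_le_univ _

variable {c} in
lemma TwoSided.mono {W W' : Finset V} (h : TwoSided c W) (hW : W ⊆ W') : TwoSided c W' :=
  fun b => let ⟨i, hi, hb⟩ := h b; ⟨i, hW hi, hb⟩

variable {c} in
lemma TwoSided.exists_ne {W : Finset V} (h : TwoSided c W) (x : V) : ∃ i ∈ W, c i ≠ c x := by
  obtain ⟨i, hi, hb⟩ := h (!c x)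
  exact ⟨i, hi, by simp [hb]⟩

variable [DecidableEq V]

/-- Restricted to `W`, the function `Q` is a parking function with respect to every root. -/
def Spreads (W : Finset V) (Q : V → ℕ) : Prop :=
  ∀ A ⊆ W, A.Nonempty → A ≠ W → ∃ i ∈ A, Q i < oppCount c i (W \ A)

/-- `Q` spreads on the two-sided set `W`, and `W` burns all of `U` in one step. -/
def Ignites (U : Finset V) (Q : V → ℕ) (W : Finset V) : Prop :=
  W ⊆ U ∧ TwoSided c W ∧ Spreads c W Q ∧ ∀ i ∈ U \ W, Q i < oppCount c i W

variable {c}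

lemma oppCount_insert_of_eq {i x : V} (h : c x = c i) (A : Finset V) :
    oppCount c i (insert x A) = oppCount c i A := by
  simp [oppCount, filter_insert, h]

lemma oppCount_erase_of_eq {i x : V} (h : c x = c i) (A : Finset V) :
    oppCount c i (A.erase x) = oppCount c i A := by
  unfold oppCount
  congr 1
  ext j
  simp only [mem_filter, mem_erase]
  constructor
  · rintro ⟨⟨_, h1⟩, h2⟩
    exact ⟨h1, h2⟩
  · rintro ⟨h1, h2⟩
    refine ⟨⟨?_, h1⟩, h2⟩
    rintro rfl
    exact h2 h

lemma oppCount_erase_of_ne {i x : V} (h : c x ≠ c i) {A : Finset V} (hx : x ∈ A) :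
    oppCount c i (A.erase x) + 1 = oppCount c i A := by
  unfold oppCount
  rw [filter_erase, card_erase_add_one]
  simp [hx, h]

namespace Ignites

variable {U W : Finset V} {Q : V → ℕ}

lemma lt_oppCount (h : Ignites c U Q W) {i : V} (hi : i ∈ U) : Q i < oppCount c i W := by
  obtain ⟨-, h2, h3, h4⟩ := h
  by_cases hW : i ∈ W
  · obtain ⟨j, hj, hji⟩ := h2.exists_ne i
    obtain ⟨k, hk, hlt⟩ := h3 {i} (by simpa using hW) (by simp) (by
      rintro rfl
      simp only [mem_singleton] at hj
      exact hji (by rw [hj]))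
    obtain rfl : k = i := by simpa using hk
    exact hlt.trans_le (oppCount_mono _ sdiff_subset)
  · exact h4 i (by simp [hi, hW])

lemma exists_zero (h : Ignites c U Q W) (x : V) : ∃ i ∈ W, c i ≠ c x ∧ Q i = 0 := by
  obtain ⟨-, h2, h3, -⟩ := h
  obtain ⟨w, hw, hwx⟩ := h2 (c x)
  obtain ⟨j, hj, hjx⟩ := h2.exists_ne x
  obtain ⟨i, hi, hlt⟩ := h3 (W.erase w) (erase_subset _ _)
    ⟨j, by
      rw [mem_erase]
      refine ⟨?_, hj⟩
      rintro rfl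
      exact hjx hwx⟩
    (by
      intro e
      have := hw
      rw [← e] at this
      simp at this)
  have hs : W \ W.erase w = {w} := by
    ext y
    simp only [mem_sdiff, mem_erase, mem_singleton]
    constructor
    · rintro ⟨h1, h2⟩
      by_contra hne
      exact h2 ⟨hne, h1⟩
    · rintro rfl
      exact ⟨hw, by simp⟩
  rw [hs] at hlt
  refine ⟨i, mem_of_mem_erase hi, ?_, ?_⟩
  · intro e
    rw [← hwx] at e
    simp [oppCount, e, filter_singleton] at hlt
  · have : oppCount c i {w} ≤ 1 := (card_filter_le _ _).trans (by simp)
    omega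

lemma insert (h : Ignites c U Q W) {x : V} (hx : x ∈ U) : Ignites c U Q (insert x W) := by
  by_cases hxW : x ∈ W
  · rwa [insert_eq_of_mem hxW]
  have hz := h.exists_zero x
  have hq := h.lt_oppCount hx
  obtain ⟨h1, h2, h3, h4⟩ := h
  refine ⟨insert_subset hx h1, h2.mono (subset_insert _ _), ?_, ?_⟩
  · intro A hA hne hAW
    by_cases hAx : A.erase x = W
    · have hxA : x ∉ A := by
        intro hxA
        apply hAW
        rw [← hAx, insert_erase hxA]
      rw [erase_eq_of_notMem hxA] at hAx
      subst hAx
      obtain ⟨i, hi, hix, hi0⟩ := hz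
      refine ⟨i, hi, ?_⟩
      rw [hi0]
      refine card_pos.2 ⟨x, ?_⟩
      simp [hxA, hix.symm]
    by_cases hAe : (A.erase x).Nonempty
    · obtain ⟨i, hi, hlt⟩ := h3 (A.erase x) (by
        intro y hy
        rw [mem_erase] at hy
        exact (mem_insert.1 (hA hy.2)).resolve_left hy.1) hAe hAx
      refine ⟨i, mem_of_mem_erase hi, hlt.trans_le (oppCount_mono _ ?_)⟩
      intro y hy
      simp only [mem_sdiff, mem_erase, mem_insert] at hy ⊢
      refine ⟨Or.inr hy.1, fun hyA => hy.2 ⟨?_, hyA⟩⟩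
      rintro rfl
      exact hxW hy.1
    · obtain ⟨y, hy⟩ := hne
      have hyx : y = x := by
        by_contra hyx
        exact hAe ⟨y, by simp [hyx, hy]⟩
      subst hyx
      refine ⟨y, hy, hq.trans_le (oppCount_mono _ ?_)⟩
      intro z hzW
      simp only [mem_sdiff, mem_insert]
      refine ⟨Or.inr hzW, fun hzA => hAe ⟨z, ?_⟩⟩
      rw [mem_erase]
      refine ⟨?_, hzA⟩
      rintro rfl
      exact hxW hzW
  · intro i hi
    simp only [mem_sdiff, mem_insert, not_or] at hi
    exact (h4 i (by simp [hi])).trans_le (oppCount_mono _ (subset_insert _ _))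

lemma erase_iff (h : Ignites c U Q W) {u v : V} (hv : v ∈ W) (hu : u ∈ U) (huv : c u ≠ c v)
    (hvmax : ∀ i ∈ U, c i = c v → Q i ≤ Q v) (humax : ∀ i ∈ U, c i = c u → Q i ≤ Q u) :
    Ignites c U Q (W.erase v) ↔ Q u + 1 < oppCount c u W := by
  have hc : ∀ i, c i ≠ c v → c i = c u := by
    intro i hi
    revert hi huv
    cases c i <;> cases c v <;> cases c u <;> simp
  have he : oppCount c u (W.erase v) + 1 = oppCount c u W := oppCount_erase_of_ne huv.symm hv
  constructor
  · intro h'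
    have := h'.lt_oppCount hu
    omega
  · intro hlt
    have hop : ∀ i ∈ U, c i ≠ c v → Q i < oppCount c i (W.erase v) := by
      intro i hi hiv
      rw [oppCount_congr (hc i hiv)]
      have := humax i hi (hc i hiv)
      omega
    have hqv := h.lt_oppCount (h.1 hv)
    have hall := @Ignites.lt_oppCount _ _ _ _ _ _ h
    obtain ⟨h1, h2, h3, h4⟩ := h
    refine ⟨(erase_subset _ _).trans h1, ?_, ?_, ?_⟩
    · intro b
      by_cases hb : b = c v
      · have : 0 < oppCount c u (W.erase v) := by omega
        obtain ⟨i, hi⟩ := card_pos.1 this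
        rw [mem_filter] at hi
        refine ⟨i, hi.1, ?_⟩
        by_contra hne
        exact hi.2 (hc i (hb ▸ hne))
      · obtain ⟨i, hi, hib⟩ := h2 b
        refine ⟨i, mem_erase.2 ⟨?_, hi⟩, hib⟩
        rintro rfl
        exact hb hib.symm
    · intro A hA hne hAW
      have hvA : v ∉ A := fun hvA => by simpa using hA hvA
      have hAW' : A ⊆ W := hA.trans (erase_subset _ _)
      have hs : W \ Insert.insert v A = W.erase v \ A := by
        ext y
        simp only [mem_sdiff, mem_insert, mem_erase]
        tauto
      obtain ⟨i, hi, hilt⟩ := h3 (Insert.insert v A) (insert_subset hv hAW') (by simp) (by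
        rintro rfl
        exact hAW (by rw [erase_insert hvA]))
      rw [hs] at hilt
      rcases mem_insert.1 hi with rfl | hi
      · by_cases hex : ∃ j ∈ A, c j = c i
        · obtain ⟨j, hj, hji⟩ := hex
          refine ⟨j, hj, ?_⟩
          rw [oppCount_congr hji]
          exact (hvmax j (h1 (hAW' hj)) hji).trans_lt hilt
        · push Not at hex
          obtain ⟨j, hj⟩ := hne
          refine ⟨j, hj, (hop j (h1 (hAW' hj)) (hex j hj)).trans_le ?_⟩
          refine card_le_card fun k hk => ?_
          rw [mem_filter] at hk ⊢
          refine ⟨mem_sdiff.2 ⟨hk.1, fun hkA => hk.2 ?_⟩, hk.2⟩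
          rw [hc k (hex k hkA), hc j (hex j hj)]
      · exact ⟨i, hi, hilt⟩
    · intro i hi
      rw [mem_sdiff] at hi
      by_cases hiv : c i = c v
      · rw [oppCount_erase_of_eq hiv.symm]
        exact hall hi.1
      · exact hop i hi.1 hiv

end Ignites

lemma sum_neg_one_pow_card_eq_of_insert_mem (fam : Finset (Finset V)) (v : V)
    (h : ∀ W ∈ fam, insert v W ∈ fam) :
    ∑ W ∈ fam, (-1 : ℤ) ^ #W = ∑ W ∈ fam with v ∈ W ∧ W.erase v ∉ fam, (-1 : ℤ) ^ #W := by
  rw [← sum_filter_add_sum_filter_not fam (fun W => v ∈ W ∧ W.erase v ∉ fam), add_eq_left]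
  refine sum_involution (fun W _ => if v ∈ W then W.erase v else insert v W) ?_ ?_ ?_ ?_
  · intro W hW
    split_ifs with hv
    · have := card_erase_add_one hv
      rw [← this, pow_succ]
      ring
    · rw [card_insert_of_notMem hv, pow_succ]
      ring
  · intro W hW _
    split_ifs with hv
    · intro e
      rw [← e] at hv
      simp at hv
    · intro e
      rw [← e] at hv
      simp at hv
  · intro W hW
    simp only [mem_filter, not_and, not_not] at hW ⊢
    split_ifs with hv
    · exact ⟨hW.2 hv, by simp⟩
    · refine ⟨h W hW.1, fun _ => ?_⟩
      rw [erase_insert hv]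
      exact hW.1
  · intro W hW
    by_cases hv : v ∈ W
    · simp [hv, insert_erase]
    · simp [hv]

open Classical in
lemma sum_ignites_neg_one_pow_card {U : Finset V} (hU : TwoSided c U) (Q : V → ℕ) :
    ∑ W ∈ U.powerset with Ignites c U Q W, (-1 : ℤ) ^ #W = if ∀ i ∈ U, Q i = 0 then 1 else 0 := by
  have hmax : ∀ b, ∃ v ∈ U, c v = b ∧ ∀ i ∈ U, c i = c v → Q i ≤ Q v := by
    intro b
    obtain ⟨i, hi, hib⟩ := hU b
    obtain ⟨v, hv, hvm⟩ := exists_max_image {j ∈ U | c j = b} Q ⟨i, by simp [hi, hib]⟩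
    rw [mem_filter] at hv
    refine ⟨v, hv.1, hv.2, fun j hj hjv => hvm j ?_⟩
    rw [mem_filter]
    exact ⟨hj, hjv.trans hv.2⟩
  obtain ⟨v, hvU, hvt, hvm⟩ := hmax true
  obtain ⟨u, huU, huf, hum⟩ := hmax false
  have huv : c u ≠ c v := by simp [huf, hvt]
  have hne : u ≠ v := fun e => huv (by rw [e])
  set fam := {W ∈ U.powerset | Ignites c U Q W} with hfam
  have mem_fam : ∀ W, W ∈ fam ↔ Ignites c U Q W := by
    intro W
    simp only [hfam, mem_filter, mem_powerset, and_iff_right_iff_imp]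
    exact fun h => h.1
  rw [sum_neg_one_pow_card_eq_of_insert_mem fam v (by
    intro W hW
    rw [mem_fam] at hW ⊢
    exact hW.insert hvU)]
  set stuck := {W ∈ fam | v ∈ W ∧ W.erase v ∉ fam} with hstuck
  have mem_stuck : ∀ W, W ∈ stuck ↔ Ignites c U Q W ∧ v ∈ W ∧ oppCount c u W ≤ Q u + 1 := by
    intro W
    simp only [hstuck, mem_filter, mem_fam]
    refine and_congr_right fun hW => and_congr_right fun hv => ?_
    rw [hW.erase_iff hv huU huv hvm hum, not_lt]
  rw [sum_neg_one_pow_card_eq_of_insert_mem stuck u (by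
    intro W hW
    rw [mem_stuck] at hW ⊢
    refine ⟨hW.1.insert huU, mem_insert_of_mem hW.2.1, ?_⟩
    rw [oppCount_insert_of_eq rfl]
    exact hW.2.2)]
  have mem_doubly : ∀ W, (W ∈ stuck ∧ u ∈ W ∧ W.erase u ∉ stuck) ↔ W = {u, v} ∧ ∀ i ∈ U, Q i = 0 := by
    intro W
    constructor
    · rintro ⟨hW, hu, hWu⟩
      rw [mem_stuck] at hW hWu
      obtain ⟨hI, hv, hcu⟩ := hW
      have hcv : oppCount c v W ≤ Q v + 1 := by
        by_contra hlt
        apply hWu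
        refine ⟨(hI.erase_iff hu hvU huv.symm hum hvm).2 (not_le.1 hlt),
          mem_erase.2 ⟨hne.symm, hv⟩, ?_⟩
        rwa [oppCount_erase_of_eq rfl]
      have hWeq : W = {u, v} := by
        by_contra hWne
        obtain ⟨i, hi, hlt⟩ := hI.2.2.1 {u, v} (by
          intro x hx
          rcases mem_insert.1 hx with rfl | hx
          · exact hu
          · rwa [mem_singleton.1 hx]) (by simp) (Ne.symm hWne)
        have hs1 : W \ {u, v} = (W.erase u).erase v := by
          ext y
          simp only [mem_sdiff, mem_insert, mem_singleton, mem_erase]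
          tauto
        have hs2 : W \ {u, v} = (W.erase v).erase u := by
          ext y
          simp only [mem_sdiff, mem_insert, mem_singleton, mem_erase]
          tauto
        rcases mem_insert.1 hi with rfl | hi
        · rw [hs2, oppCount_erase_of_eq rfl] at hlt
          have := oppCount_erase_of_ne huv.symm hv
          omega
        · obtain rfl := mem_singleton.1 hi
          rw [hs1, oppCount_erase_of_eq rfl] at hlt
          have := oppCount_erase_of_ne huv hu
          omega
      refine ⟨hWeq, fun i hi => ?_⟩
      have h1 := hI.lt_oppCount hi
      rw [hWeq] at h1
      have h2 : oppCount c i {u, v} ≤ 1 := by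
        unfold oppCount
        rw [card_le_one]
        intro a ha b hb
        simp only [mem_filter, mem_insert, mem_singleton] at ha hb
        rcases ha with ⟨rfl | rfl, ha⟩ <;> rcases hb with ⟨rfl | rfl, hb⟩ <;> try rfl
        · exact absurd (by
            revert ha hb huv
            cases c a <;> cases c b <;> cases c i <;> simp) huv
        · exact absurd (by
            revert ha hb huv
            cases c a <;> cases c b <;> cases c i <;> simp) huv
      omega
    · rintro ⟨rfl, hQ⟩
      have hs : ∀ i, oppCount c i {u, v} = 1 := by
        intro i
        unfold oppCount
        rw [filter_insert, filter_singleton]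
        rw [huf, hvt]
        cases c i <;> simp
      have hI : Ignites c U Q {u, v} := by
        refine ⟨?_, ?_, ?_, ?_⟩
        · intro x hx
          rcases mem_insert.1 hx with rfl | hx
          · exact huU
          · rwa [mem_singleton.1 hx]
        · rintro (_ | _)
          · exact ⟨u, by simp, huf⟩
          · exact ⟨v, by simp, hvt⟩
        · intro A hA hAne hAW
          by_cases hu : u ∈ A
          · have hv : v ∉ A := fun hv => hAW (subset_antisymm hA (by
              intro x hx
              rcases mem_insert.1 hx with rfl | hx
              · exact hu
              · rwa [mem_singleton.1 hx]))
            refine ⟨u, hu, ?_⟩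
            rw [hQ u huU]
            exact card_pos.2 ⟨v, by simp [hv, huv.symm]⟩
          · obtain ⟨x, hx⟩ := hAne
            have hxv : x = v := by
              rcases mem_insert.1 (hA hx) with rfl | h
              · exact absurd hx hu
              · exact mem_singleton.1 h
            subst hxv
            refine ⟨x, hx, ?_⟩
            rw [hQ x hvU]
            exact card_pos.2 ⟨u, by simp [hu, huv]⟩
        · intro i hi
          rw [hs, hQ i (mem_sdiff.1 hi).1]
          exact one_pos
      refine ⟨(mem_stuck _).2 ⟨hI, by simp, by rw [hs]; omega⟩, by simp, fun h => ?_⟩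
      have h1 := ((mem_stuck _).1 h).1.lt_oppCount hvU
      have h2 := oppCount_erase_of_ne huv (mem_insert_self u {v})
      rw [hs] at h2
      omega
  have hfin : {W ∈ stuck | u ∈ W ∧ W.erase u ∉ stuck} =
      if ∀ i ∈ U, Q i = 0 then {({u, v} : Finset V)} else ∅ := by
    ext W
    rw [mem_filter, mem_doubly]
    split_ifs with h
    · rw [and_iff_left h, mem_singleton]
    · simp only [h, and_false, notMem_empty]
  rw [hfin]
  split_ifs with h
  · simp [card_pair hne]
  · simp

lemma spreads_congr {W : Finset V} {Q Q' : V → ℕ} (h : ∀ i ∈ W, Q i = Q' i) :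
    Spreads c W Q ↔ Spreads c W Q' := by
  refine forall_congr' fun A => forall_congr' fun hA => forall_congr' fun _ =>
    forall_congr' fun _ => exists_congr fun i => and_congr_right fun hi => ?_
  rw [h i (hA hi)]

open Classical in
lemma sum_not_twoSided {U : Finset V} (hU : TwoSided c U) :
    ∑ W ∈ U.powerset with ¬ TwoSided c W, (-1 : ℤ) ^ #W = -1 := by
  have hside : ∀ b, ∑ W ∈ ({i ∈ U | c i = b}).powerset, (-1 : ℤ) ^ #W = 0 := by
    intro b
    rw [sum_powerset_neg_one_pow_card, if_neg]
    obtain ⟨i, hi, hb⟩ := hU b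
    exact ne_empty_of_mem (mem_filter.2 ⟨hi, hb⟩)
  have hunion : {W ∈ U.powerset | ¬ TwoSided c W} =
      ({i ∈ U | c i = true}).powerset ∪ ({i ∈ U | c i = false}).powerset := by
    ext W
    simp only [TwoSided, Bool.forall_bool, mem_filter, mem_powerset, mem_union, subset_iff]
    constructor
    · rintro ⟨h1, h2⟩
      by_cases hf : ∃ i ∈ W, c i = false
      · right
        intro i hi
        refine ⟨h1 hi, ?_⟩
        by_contra hne
        exact h2 ⟨hf, i, hi, by simpa using hne⟩
      · left
        intro i hi
        refine ⟨h1 hi, ?_⟩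
        by_contra hne
        exact hf ⟨i, hi, by simpa using hne⟩
    · rintro (h | h)
      · refine ⟨fun i hi => (h hi).1, ?_⟩
        rintro ⟨⟨i, hi, hif⟩, -⟩
        simpa [hif] using (h hi).2
      · refine ⟨fun i hi => (h hi).1, ?_⟩
        rintro ⟨-, ⟨i, hi, hif⟩⟩
        simpa [hif] using (h hi).2
  have hinter : ({i ∈ U | c i = true}).powerset ∩ ({i ∈ U | c i = false}).powerset = {∅} := by
    ext W
    simp only [mem_inter, mem_powerset, mem_singleton]
    constructor
    · rintro ⟨h1, h2⟩
      rw [eq_empty_iff_forall_notMem]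
      intro i hi
      have h3 := (mem_filter.1 (h1 hi)).2
      have h4 := (mem_filter.1 (h2 hi)).2
      simp [h3] at h4
    · rintro rfl
      simp
  have h := sum_union_inter (s₁ := ({i ∈ U | c i = true}).powerset)
    (s₂ := ({i ∈ U | c i = false}).powerset) (f := fun W => (-1 : ℤ) ^ #W)
  rw [hinter, hside, hside, sum_singleton] at h
  rw [hunion]
  simp only [card_empty, pow_zero] at h
  omega

section Counting

variable [Fintype V]

/-- The functions `V → ℕ` with values below `Fintype.card V` that vanish outside `U`. -/
def boundedFuns (U : Finset V) : Finset (V → ℕ) :=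
  Fintype.piFinset fun i => if i ∈ U then range (Fintype.card V) else {0}

lemma mem_boundedFuns {U : Finset V} {Q : V → ℕ} :
    Q ∈ boundedFuns U ↔ (∀ i ∈ U, Q i < Fintype.card V) ∧ ∀ i ∉ U, Q i = 0 := by
  simp only [boundedFuns, Fintype.mem_piFinset]
  constructor
  · refine fun h => ⟨fun i hi => ?_, fun i hi => ?_⟩
    · simpa [hi] using h i
    · simpa [hi] using h i
  · rintro ⟨h1, h2⟩ i
    by_cases hi : i ∈ U
    · simpa [hi] using h1 i hi
    · simpa [hi] using h2 i hi

open Classical in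
variable (c) in
/-- The number of functions bounded by `Fintype.card V` that spread on `U`. -/
noncomputable def spreadCount (U : Finset V) : ℕ := #{Q ∈ boundedFuns U | Spreads c U Q}

open Classical in
lemma card_ignites {U W : Finset V} (hWU : W ⊆ U) (hW : TwoSided c W) :
    #{Q ∈ boundedFuns U | Ignites c U Q W} =
      spreadCount c W * ∏ i ∈ U \ W, oppCount c i W := by
  have hprod : ∏ i ∈ U \ W, oppCount c i W =
      #(Fintype.piFinset fun i => if i ∈ U \ W then range (oppCount c i W) else {0}) := by
    rw [Fintype.card_piFinset, ← prod_subset (subset_univ (U \ W))]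
    · refine prod_congr rfl fun i hi => ?_
      rw [if_pos hi, card_range]
    · intro i _ hi
      rw [if_neg hi, card_singleton]
  rw [hprod, spreadCount, ← card_product]
  refine card_nbij' (fun Q => (W.piecewise Q 0, W.piecewise 0 Q))
    (fun Q => W.piecewise Q.1 Q.2) ?_ ?_ ?_ ?_
  · intro Q hQ
    simp only [coe_filter, Set.mem_ofPred_eq, mem_boundedFuns] at hQ
    obtain ⟨⟨h1, h2⟩, -, -, h3, h4⟩ := hQ
    simp only [coe_product, Set.mem_prod, coe_filter, Set.mem_ofPred_eq, mem_boundedFuns, mem_coe,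
      Fintype.mem_piFinset]
    refine ⟨⟨⟨fun i hi => ?_, fun i hi => ?_⟩, ?_⟩, fun i => ?_⟩
    · simpa [hi] using h1 i (hWU hi)
    · simp [hi]
    · refine (spreads_congr fun i hi => ?_).2 h3
      simp [hi]
    · by_cases hi : i ∈ W
      · simp [hi]
      · by_cases hiU : i ∈ U
        · simpa [hi, hiU] using h4 i (by simp [hi, hiU])
        · simpa [hi, hiU] using h2 i hiU
  · rintro ⟨Q, Q'⟩ hQ
    simp only [coe_product, Set.mem_prod, coe_filter, Set.mem_ofPred_eq, mem_boundedFuns, mem_coe,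
      Fintype.mem_piFinset] at hQ
    obtain ⟨⟨⟨h1, h2⟩, h3⟩, h4⟩ := hQ
    have h5 : ∀ i ∈ U \ W, Q' i < oppCount c i W := fun i hi => by
      have := h4 i
      rwa [if_pos hi, mem_range] at this
    simp only [coe_filter, Set.mem_ofPred_eq, mem_boundedFuns]
    refine ⟨⟨fun i hi => ?_, fun i hi => ?_⟩, hWU, hW, ?_, fun i hi => ?_⟩
    · by_cases hiW : i ∈ W
      · simpa [hiW] using h1 i hiW
      · simpa [hiW] using (h5 i (by simp [hi, hiW])).trans_le (oppCount_le_card _ _)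
    · have hiW : i ∉ W := fun h => hi (hWU h)
      simpa [hi, hiW] using h4 i
    · refine (spreads_congr fun i hi => ?_).2 h3
      simp [hi]
    · simpa [(mem_sdiff.1 hi).2] using h5 i hi
  · intro Q hQ
    ext i
    by_cases hi : i ∈ W <;> simp [hi]
  · rintro ⟨Q, Q'⟩ hQ
    simp only [coe_product, Set.mem_prod, coe_filter, Set.mem_ofPred_eq, mem_boundedFuns, mem_coe,
      Fintype.mem_piFinset] at hQ
    obtain ⟨⟨⟨h1, h2⟩, h3⟩, h4⟩ := hQ
    ext i
    · by_cases hi : i ∈ W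
      · simp [hi]
      · simp [hi, h2 i hi]
    · by_cases hi : i ∈ W
      · simpa [hi, eq_comm] using h4 i
      · simp [hi]

open Classical in
lemma sum_neg_one_pow_card_mul_spreadCount {U : Finset V} (hU : TwoSided c U) :
    ∑ W ∈ U.powerset with TwoSided c W,
      (-1 : ℤ) ^ #W * (spreadCount c W * ∏ i ∈ U \ W, (oppCount c i W : ℤ)) = 1 := by
  have hstep : ∀ W ∈ U.powerset.filter (TwoSided c),
      (-1 : ℤ) ^ #W * (spreadCount c W * ∏ i ∈ U \ W, (oppCount c i W : ℤ)) =
        ∑ Q ∈ boundedFuns U, if Ignites c U Q W then (-1 : ℤ) ^ #W else 0 := by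
    intro W hW
    rw [mem_filter, mem_powerset] at hW
    rw [← sum_filter, sum_const, card_ignites hW.1 hW.2]
    simp [mul_comm]
  rw [sum_congr rfl hstep, sum_comm]
  have hQ : ∀ Q ∈ boundedFuns U,
      ∑ W ∈ U.powerset with TwoSided c W, (if Ignites c U Q W then (-1 : ℤ) ^ #W else 0) =
        if Q = 0 then 1 else 0 := by
    intro Q hQ
    rw [mem_boundedFuns] at hQ
    rw [← sum_filter, filter_filter]
    have hf : {W ∈ U.powerset | TwoSided c W ∧ Ignites c U Q W} =
        {W ∈ U.powerset | Ignites c U Q W} :=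
      filter_congr fun W _ => and_iff_right_of_imp fun h => h.2.1
    rw [hf, sum_ignites_neg_one_pow_card hU]
    congr 1
    refine propext ⟨fun h => ?_, fun h => by simp [h]⟩
    ext i
    by_cases hi : i ∈ U
    · exact h i hi
    · exact hQ.2 i hi
  rw [sum_congr rfl hQ, sum_ite_eq', if_pos]
  rw [mem_boundedFuns]
  obtain ⟨v, -⟩ := hU true
  exact ⟨fun _ _ => Fintype.card_pos_iff.2 ⟨v⟩, fun _ _ => rfl⟩

open Classical in
variable (c) in
/-- The matrix, indexed by subsets of `V`, of one-step weights `U → W` for `W ⊂ U`. -/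
noncomputable def blockMatrix : Matrix (Finset V) (Finset V) ℤ := Matrix.of fun U W =>
  if W ⊂ U then if TwoSided c W then ∏ i ∈ U \ W, (oppCount c i W : ℤ) else 1 else 0

open Classical in
variable (c) in
/-- The signed number of functions that spread on `U`, set to `±1` if `U` is not two-sided. -/
noncomputable def signedCount (U : Finset V) : ℤ :=
  (-1) ^ #U * if TwoSided c U then (spreadCount c U : ℤ) else 1

lemma one_add_blockMatrix_mulVec :
    (1 + blockMatrix c).mulVec (signedCount c) = Pi.single ∅ 1 := by
  classical
  ext U
  have hsplit : ((1 + blockMatrix c).mulVec (signedCount c)) U =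
      ∑ W ∈ U.powerset, (if TwoSided c W then
        (-1 : ℤ) ^ #W * (spreadCount c W * ∏ i ∈ U \ W, (oppCount c i W : ℤ)) else (-1) ^ #W) := by
    rw [Matrix.add_mulVec, Matrix.one_mulVec, Pi.add_apply]
    have hp : U.powerset = insert U U.ssubsets := by
      rw [ssubsets, insert_erase (mem_powerset_self U)]
    rw [hp, sum_insert (by simp)]
    congr 1
    · rw [signedCount]
      split_ifs <;> simp
    · rw [Matrix.mulVec, dotProduct, ← sum_subset (subset_univ U.ssubsets)]
      · refine sum_congr rfl fun W hW => ?_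
        rw [mem_ssubsets] at hW
        rw [blockMatrix, Matrix.of_apply, if_pos hW, signedCount]
        split_ifs <;> ring
      · intro W _ hW
        rw [mem_ssubsets] at hW
        rw [blockMatrix, Matrix.of_apply, if_neg hW, zero_mul]
  rw [hsplit]
  by_cases hU : TwoSided c U
  · rw [sum_ite, sum_neg_one_pow_card_mul_spreadCount hU, sum_not_twoSided hU, Pi.single_eq_of_ne]
    · norm_num
    · rintro rfl
      obtain ⟨i, hi, -⟩ := hU true
      simp at hi
  · rw [sum_congr rfl fun W hW => if_neg fun h => hU (h.mono (mem_powerset.1 hW)),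
      sum_powerset_neg_one_pow_card, Pi.single_apply]

lemma blockMatrix_pow_apply_ne_zero {k : ℕ} {U W : Finset V} (h : (blockMatrix c ^ k) U W ≠ 0) :
    #W + k ≤ #U := by
  induction k generalizing U with
  | zero =>
    rw [pow_zero, Matrix.one_apply] at h
    have : U = W := by
      by_contra hne
      simp [hne] at h
    simp [this]
  | succ k ih =>
    rw [pow_succ', Matrix.mul_apply] at h
    obtain ⟨X, -, hX⟩ := exists_ne_zero_of_sum_ne_zero h
    have h1 := ih (right_ne_zero_of_mul hX)
    have h2 : X ⊂ U := by
      by_contra hne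
      refine left_ne_zero_of_mul hX ?_
      rw [blockMatrix, Matrix.of_apply, if_neg hne]
    have := card_lt_card h2
    omega

lemma signedCount_eq_sum (U : Finset V) : signedCount c U =
    ∑ k ∈ range (Fintype.card V + 1), (-1) ^ k * (blockMatrix c ^ k) U ∅ := by
  have hnil : (-blockMatrix c) ^ (Fintype.card V + 1) = 0 := by
    rw [neg_pow]
    have : blockMatrix c ^ (Fintype.card V + 1) = 0 := by
      ext U W
      by_contra hne
      have h1 := blockMatrix_pow_apply_ne_zero hne
      have h2 := card_le_univ U
      omega
    rw [this, mul_zero]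
  have hgeom := geom_sum_mul_neg (-blockMatrix c) (Fintype.card V + 1)
  rw [hnil, sub_zero, sub_neg_eq_add] at hgeom
  have h : signedCount c =
      (∑ k ∈ range (Fintype.card V + 1), (-blockMatrix c) ^ k).mulVec (Pi.single ∅ 1) := by
    rw [← one_add_blockMatrix_mulVec, Matrix.mulVec_mulVec, hgeom, Matrix.one_mulVec]
  rw [h, Matrix.mulVec_single_one, Matrix.col_apply, Matrix.sum_apply]
  refine sum_congr rfl fun k _ => ?_
  rw [← neg_one_smul ℤ (blockMatrix c), smul_pow, Matrix.smul_apply, smul_eq_mul]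

end Counting

end Burning

lemma matrix_pow_apply_eq_sum_prod {β R : Type*} [Fintype β] [DecidableEq β] [CommSemiring R]
    (M : Matrix β β R) (k : ℕ) (p q : β) :
    (M ^ k) p q = ∑ γ : Fin (k + 1) → β,
      if γ 0 = p ∧ γ (Fin.last k) = q then ∏ j : Fin k, M (γ j.castSucc) (γ j.succ) else 0 := by
  induction k generalizing p with
  | zero =>
    rw [← (Equiv.funUnique (Fin 1) β).symm.sum_comp]
    simp only [pow_zero, Matrix.one_apply, Equiv.funUnique_symm_apply, uniqueElim_const,
      univ_eq_empty, prod_empty, ite_and]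
    simp
  | succ k ih =>
    rw [pow_succ', Matrix.mul_apply, ← (Fin.consEquiv fun _ => β).sum_comp, Fintype.sum_prod_type]
    simp only [Fin.consEquiv_apply, Fin.cons_zero, ite_and]
    rw [Finset.sum_comm]
    simp only [sum_ite_eq', mem_univ, if_true]
    simp only [ih, mul_sum]
    rw [Finset.sum_comm]
    refine sum_congr rfl fun γ _ => ?_
    rw [sum_eq_single (γ 0)]
    · rw [← Fin.succ_last, Fin.cons_succ]
      simp only [true_and, Fin.prod_univ_succ (n := k), Fin.castSucc_zero, Fin.cons_zero,
        Fin.cons_succ, ← Fin.succ_castSucc, mul_ite, mul_zero]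
    · intro r _ hr
      simp [hr.symm]
    · simp

lemma factorial_sub_eq_prod (m k : ℕ) (s : Fin (k + 1) → ℕ) (hs : ∀ j, s j ≤ m)
    (hmono : ∀ j : Fin k, s j.castSucc ≤ s j.succ) :
    (m - s 0).factorial =
      (∏ j : Fin k, (m - s j.castSucc).choose (s j.succ - s j.castSucc)) *
        (∏ j : Fin k, (s j.succ - s j.castSucc).factorial) * (m - s (Fin.last k)).factorial := by
  induction k with
  | zero => simp
  | succ k ih =>
    have h1 := ih (fun j => s j.castSucc) (fun j => hs _) (fun j => hmono j.castSucc)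
    have h2 := hmono (Fin.last k)
    have h3 := hs (Fin.last k).succ
    have h4 := Nat.choose_mul_factorial_mul_factorial
      (n := m - s (Fin.last k).castSucc) (k := s (Fin.last k).succ - s (Fin.last k).castSucc)
      (by omega)
    have h5 : m - s (Fin.last k).castSucc - (s (Fin.last k).succ - s (Fin.last k).castSucc) =
      m - s (Fin.last k).succ := by omega
    rw [h5] at h4
    rw [Fin.castSucc_zero] at h1
    rw [h1, ← h4, Fin.prod_univ_castSucc, Fin.prod_univ_castSucc (n := k), Fin.succ_last]
    simp only [Fin.succ_castSucc]
    ring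

lemma factorial_div_prod_factorial (m k : ℕ) (s : Fin (k + 1) → Fin (m + 1))
    (h0 : (s 0 : ℕ) = 0) (hl : (s (Fin.last k) : ℕ) = m)
    (hmono : ∀ j : Fin k, (s j.castSucc : ℕ) ≤ s j.succ) :
    (m.factorial : ℤ) / (∏ j : Fin k, ((s j.succ : ℕ) - (s j.castSucc : ℕ)).factorial : ℕ) =
      (∏ j : Fin k, (m - (s j.castSucc : ℕ)).choose ((s j.succ : ℕ) - s j.castSucc) : ℕ) := by
  have h := factorial_sub_eq_prod m k (fun j => (s j : ℕ)) (fun j => Nat.lt_succ_iff.1 (s j).2) hmono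
  simp only [h0, hl, Nat.sub_self, Nat.factorial_zero, mul_one, Nat.sub_zero] at h
  rw [h, Nat.cast_mul]
  refine Int.mul_ediv_cancel _ (Nat.cast_ne_zero.2 (prod_ne_zero_iff.2 fun j _ => ?_))
  exact Nat.factorial_ne_zero _

/-- The transfer matrix on pairs of part sizes, whose powers enumerate weighted chains. -/
def transferMatrix (m n : ℕ) : Matrix (Fin (m + 1) × Fin (n + 1)) (Fin (m + 1) × Fin (n + 1)) ℤ :=
  Matrix.of fun q p =>
    if (q.1 : ℕ) ≤ p.1 ∧ (q.2 : ℕ) ≤ p.2 ∧ (q.1 : ℕ) + q.2 < p.1 + p.2 then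
      (((m - (q.1 : ℕ)).choose ((p.1 : ℕ) - q.1) * (n - (q.2 : ℕ)).choose ((p.2 : ℕ) - q.2) *
        (if (p.1 : ℕ) < m ∧ (p.2 : ℕ) < n then
          (n - (p.2 : ℕ)) ^ ((p.1 : ℕ) - q.1) * (m - (p.1 : ℕ)) ^ ((p.2 : ℕ) - q.2)
        else 1) : ℕ) : ℤ)
    else 0

lemma transferMatrix_pow_apply (m n i : ℕ) :
    (transferMatrix m n ^ i) (0, 0) (Fin.last m, Fin.last n) =
        ∑ st : (Fin (i + 1) → Fin (m + 1)) × (Fin (i + 1) → Fin (n + 1)),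
          if ((st.1 0 : ℕ) = 0 ∧ (st.2 0 : ℕ) = 0 ∧
              (∀ j : Fin i, (st.1 j.castSucc : ℕ) ≤ (st.1 j.succ : ℕ)) ∧
              (∀ j : Fin i, (st.2 j.castSucc : ℕ) ≤ (st.2 j.succ : ℕ)) ∧
              (st.1 (Fin.last i) : ℕ) = m ∧ (st.2 (Fin.last i) : ℕ) = n ∧
              ∀ j : Fin i, (st.1 j.castSucc : ℕ) + (st.2 j.castSucc : ℕ) <
                (st.1 j.succ : ℕ) + (st.2 j.succ : ℕ))
          then ((Nat.factorial m /
                  ∏ j : Fin i, Nat.factorial ((st.1 j.succ : ℕ) - (st.1 j.castSucc : ℕ))) *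
                (Nat.factorial n /
                  ∏ j : Fin i, Nat.factorial ((st.2 j.succ : ℕ) - (st.2 j.castSucc : ℕ))) *
                ∏ j : Fin i,
                  (if (st.1 j.succ : ℕ) < m ∧ (st.2 j.succ : ℕ) < n then
                    (n - (st.2 j.succ : ℕ)) ^ ((st.1 j.succ : ℕ) - (st.1 j.castSucc : ℕ)) *
                    (m - (st.1 j.succ : ℕ)) ^ ((st.2 j.succ : ℕ) - (st.2 j.castSucc : ℕ))
                  else 1) : ℤ)
          else 0 := by
  rw [matrix_pow_apply_eq_sum_prod,
    ← (Equiv.arrowProdEquivProdArrow (Fin (i + 1)) (fun _ => Fin (m + 1))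
      (fun _ => Fin (n + 1))).symm.sum_comp]
  refine sum_congr rfl fun st _ => ?_
  obtain ⟨s, t⟩ := st
  simp only [Equiv.arrowProdEquivProdArrow, Equiv.coe_fn_symm_mk, Prod.mk.injEq, Fin.ext_iff,
    Fin.val_zero, Fin.val_last]
  by_cases hstep : ∀ j : Fin i, (s j.castSucc : ℕ) ≤ s j.succ ∧ (t j.castSucc : ℕ) ≤ t j.succ ∧
      (s j.castSucc : ℕ) + t j.castSucc < s j.succ + t j.succ
  · by_cases hends : ((s 0 : ℕ) = 0 ∧ (t 0 : ℕ) = 0) ∧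
        (s (Fin.last i) : ℕ) = m ∧ (t (Fin.last i) : ℕ) = n
    · rw [if_pos hends, if_pos ⟨hends.1.1, hends.1.2, fun j => (hstep j).1, fun j => (hstep j).2.1,
        hends.2.1, hends.2.2, fun j => (hstep j).2.2⟩,
        factorial_div_prod_factorial m i s hends.1.1 hends.2.1 fun j => (hstep j).1,
        factorial_div_prod_factorial n i t hends.1.2 hends.2.2 fun j => (hstep j).2.1,
        ← Nat.cast_mul, ← Nat.cast_mul, ← prod_mul_distrib, ← prod_mul_distrib, Nat.cast_prod]
      refine prod_congr rfl fun j _ => ?_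
      rw [transferMatrix, Matrix.of_apply, if_pos (hstep j)]
    · rw [if_neg hends, if_neg]
      rintro ⟨h1, h2, -, -, h3, h4, -⟩
      exact hends ⟨⟨h1, h2⟩, h3, h4⟩
  · refine Eq.trans ?_
      (if_neg fun h => hstep fun j => ⟨h.2.2.1 j, h.2.2.2.1 j, h.2.2.2.2.2.2 j⟩).symm
    push Not at hstep
    obtain ⟨j, hj⟩ := hstep
    split_ifs
    · refine prod_eq_zero (mem_univ j) ?_
      rw [transferMatrix, Matrix.of_apply, if_neg]
      rintro ⟨h1, h2, h3⟩
      exact absurd h3 (not_lt.2 (hj h1 h2))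
    · rfl

section Lumping

variable {V : Type*} (c : V → Bool)

/-- The number of vertices of `W` of colour `b`. -/
def colorCount (b : Bool) (W : Finset V) : ℕ := #{i ∈ W | c i = b}

variable {c}

lemma colorCount_mono (b : Bool) {A B : Finset V} (h : A ⊆ B) :
    colorCount c b A ≤ colorCount c b B :=
  card_le_card (filter_subset_filter _ h)

lemma oppCount_eq_colorCount (i : V) (W : Finset V) :
    oppCount c i W = colorCount c (!c i) W := by
  simp [oppCount, colorCount, ← Bool.eq_not]

lemma twoSided_iff_colorCount_pos {W : Finset V} :
    TwoSided c W ↔ 0 < colorCount c true W ∧ 0 < colorCount c false W := by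
  simp [TwoSided, colorCount, card_pos, Finset.Nonempty, and_comm]

lemma colorCount_add (W : Finset V) : colorCount c true W + colorCount c false W = #W := by
  have := card_filter_add_card_filter_not (s := W) (fun i => c i = true)
  simpa [colorCount] using this

variable (c) in
/-- The numbers of vertices of each colour outside `W`, when there are `m` and `n` in total. -/
def complCounts (m n : ℕ) (W : Finset V) : Fin (m + 1) × Fin (n + 1) :=
  (⟨m - colorCount c true W, by omega⟩, ⟨n - colorCount c false W, by omega⟩)

lemma complCounts_eq_iff [Fintype V] {m n : ℕ}
    (hm : colorCount c true univ = m) (hn : colorCount c false univ = n)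
    (W : Finset V) (p : Fin (m + 1) × Fin (n + 1)) :
    complCounts c m n W = p ↔
      colorCount c true W = m - (p.1 : ℕ) ∧ colorCount c false W = n - (p.2 : ℕ) := by
  have h1 := colorCount_mono (c := c) true (subset_univ W)
  have h2 := colorCount_mono (c := c) false (subset_univ W)
  have h3 := p.1.2
  have h4 := p.2.2
  simp only [complCounts, Prod.ext_iff, Fin.ext_iff]
  omega

variable [DecidableEq V]

lemma colorCount_sdiff (b : Bool) {U W : Finset V} (h : W ⊆ U) :
    colorCount c b (U \ W) = colorCount c b U - colorCount c b W := by
  unfold colorCount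
  rw [← card_sdiff_of_subset (filter_subset_filter _ h)]
  congr 1
  ext i
  simp only [mem_filter, mem_sdiff]
  tauto

lemma prod_oppCount {U W : Finset V} (h : W ⊆ U) :
    ∏ i ∈ U \ W, oppCount c i W =
      colorCount c false W ^ (colorCount c true U - colorCount c true W) *
        colorCount c true W ^ (colorCount c false U - colorCount c false W) := by
  rw [← prod_filter_mul_prod_filter_not (U \ W) (fun i => c i = true),
    ← colorCount_sdiff _ h, ← colorCount_sdiff _ h]
  congr 1
  · refine prod_eq_pow_card fun i hi => ?_
    rw [oppCount_eq_colorCount, (mem_filter.1 hi).2, Bool.not_true]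
  · simp only [Bool.not_eq_true]
    refine prod_eq_pow_card fun i hi => ?_
    rw [oppCount_eq_colorCount, (mem_filter.1 hi).2, Bool.not_false]

lemma card_filter_colorCount (U : Finset V) (a b : ℕ) :
    #{W ∈ U.powerset | colorCount c true W = a ∧ colorCount c false W = b} =
      (colorCount c true U).choose a * (colorCount c false U).choose b := by
  unfold colorCount
  rw [← card_powersetCard, ← card_powersetCard, ← card_product]
  refine card_nbij' (fun W => ({i ∈ W | c i = true}, {i ∈ W | c i = false}))
    (fun W => W.1 ∪ W.2) ?_ ?_ ?_ ?_
  · intro W hW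
    simp only [coe_filter, mem_powerset, Set.mem_ofPred_eq] at hW
    simp only [coe_product, Set.mem_prod, mem_coe, mem_powersetCard]
    exact ⟨⟨filter_subset_filter _ hW.1, hW.2.1⟩, filter_subset_filter _ hW.1, hW.2.2⟩
  · rintro ⟨A, B⟩ h
    simp only [coe_product, Set.mem_prod, mem_coe, mem_powersetCard] at h
    obtain ⟨⟨hA, hAa⟩, hB, hBb⟩ := h
    have hA' : ∀ i ∈ A, c i = true := fun i hi => (mem_filter.1 (hA hi)).2
    have hB' : ∀ i ∈ B, c i = false := fun i hi => (mem_filter.1 (hB hi)).2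
    simp only [coe_filter, mem_powerset, Set.mem_ofPred_eq]
    refine ⟨union_subset (hA.trans (filter_subset _ _)) (hB.trans (filter_subset _ _)), ?_, ?_⟩
    · rw [filter_union, filter_true_of_mem hA', filter_false_of_mem (fun i hi => by simp [hB' i hi]),
        union_empty, hAa]
    · rw [filter_union, filter_true_of_mem hB', filter_false_of_mem (fun i hi => by simp [hA' i hi]),
        empty_union, hBb]
  · intro W _
    ext i
    simp only [mem_union, mem_filter]
    cases c i <;> simp
  · rintro ⟨A, B⟩ h
    simp only [coe_product, Set.mem_prod, mem_coe, mem_powersetCard] at h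
    obtain ⟨⟨hA, hAa⟩, hB, hBb⟩ := h
    have hA' : ∀ i ∈ A, c i = true := fun i hi => (mem_filter.1 (hA hi)).2
    have hB' : ∀ i ∈ B, c i = false := fun i hi => (mem_filter.1 (hB hi)).2
    refine Prod.ext ?_ ?_
    · simp only
      rw [filter_union, filter_true_of_mem hA', filter_false_of_mem (fun i hi => by simp [hB' i hi]),
        union_empty]
    · simp only
      rw [filter_union, filter_true_of_mem hB', filter_false_of_mem (fun i hi => by simp [hA' i hi]),
        empty_union]

variable [Fintype V] {m n : ℕ}

lemma sum_blockMatrix (hm : colorCount c true univ = m) (hn : colorCount c false univ = n)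
    (U : Finset V) (p : Fin (m + 1) × Fin (n + 1)) :
    ∑ W with complCounts c m n W = p, blockMatrix c U W =
      transferMatrix m n (complCounts c m n U) p := by
  classical
  have h1 := colorCount_mono (c := c) true (subset_univ U)
  have h2 := colorCount_mono (c := c) false (subset_univ U)
  have h3 := p.1.2
  have h4 := p.2.2
  rw [hm] at h1
  rw [hn] at h2
  rw [transferMatrix, Matrix.of_apply]
  simp only [complCounts_eq_iff hm hn]
  have hssub : ∀ W ⊂ U, colorCount c true W = m - (p.1 : ℕ) ∧ colorCount c false W = n - (p.2 : ℕ) →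
      m - colorCount c true U ≤ p.1 ∧ n - colorCount c false U ≤ p.2 ∧
        m - colorCount c true U + (n - colorCount c false U) < p.1 + p.2 := by
    rintro W hW ⟨hW1, hW2⟩
    have h5 := colorCount_mono (c := c) true hW.1
    have h6 := colorCount_mono (c := c) false hW.1
    have h7 := card_lt_card hW
    rw [← colorCount_add (c := c) W, ← colorCount_add (c := c) U] at h7
    omega
  by_cases hcond : ((complCounts c m n U).1 : ℕ) ≤ p.1 ∧ ((complCounts c m n U).2 : ℕ) ≤ p.2 ∧
      ((complCounts c m n U).1 : ℕ) + (complCounts c m n U).2 < p.1 + p.2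
  · rw [if_pos hcond]
    simp only [complCounts] at hcond ⊢
    have hterm : ∀ W ∈ ({W | colorCount c true W = m - (p.1 : ℕ) ∧
        colorCount c false W = n - (p.2 : ℕ)} : Finset (Finset V)),
        blockMatrix c U W = if W ∈ U.powerset then
          (((if (p.1 : ℕ) < m ∧ (p.2 : ℕ) < n then
            (n - (p.2 : ℕ)) ^ ((p.1 : ℕ) - (m - colorCount c true U)) *
              (m - (p.1 : ℕ)) ^ ((p.2 : ℕ) - (n - colorCount c false U))
          else 1) : ℕ) : ℤ) else 0 := by
      intro W hW
      obtain ⟨-, hW1, hW2⟩ := mem_filter.1 hW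
      have hiff : W ⊂ U ↔ W ∈ U.powerset := by
        rw [mem_powerset, ssubset_iff_subset_ne, and_iff_left_iff_imp]
        rintro - rfl
        omega
      have htwo : TwoSided c W ↔ (p.1 : ℕ) < m ∧ (p.2 : ℕ) < n := by
        rw [twoSided_iff_colorCount_pos]
        omega
      rw [blockMatrix, Matrix.of_apply]
      simp only [hiff, htwo]
      split_ifs with hWU
      · rw [← Nat.cast_prod, prod_oppCount (mem_powerset.1 hWU), hW1, hW2,
          show colorCount c true U - (m - (p.1 : ℕ)) = p.1 - (m - colorCount c true U) by omega,
          show colorCount c false U - (n - (p.2 : ℕ)) = p.2 - (n - colorCount c false U) by omega]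
      · simp
      · rfl
    rw [sum_congr rfl hterm, ← sum_filter, sum_const, filter_filter]
    have hset : ({W | (colorCount c true W = m - (p.1 : ℕ) ∧ colorCount c false W = n - (p.2 : ℕ)) ∧
        W ∈ U.powerset} : Finset (Finset V)) = {W ∈ U.powerset |
          colorCount c true W = m - (p.1 : ℕ) ∧ colorCount c false W = n - (p.2 : ℕ)} := by
      ext W
      simp only [mem_filter, mem_univ, true_and]
      tauto
    rw [hset, card_filter_colorCount, nsmul_eq_mul, ← Nat.cast_mul, Nat.sub_sub_self h1,
      Nat.sub_sub_self h2, Nat.choose_symm_of_eq_add (a := m - (p.1 : ℕ))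
        (b := p.1 - (m - colorCount c true U)) (by omega),
      Nat.choose_symm_of_eq_add (a := n - (p.2 : ℕ))
        (b := p.2 - (n - colorCount c false U)) (by omega)]
  · rw [if_neg hcond]
    refine sum_eq_zero fun W hW => ?_
    rw [blockMatrix, Matrix.of_apply, if_neg]
    exact fun hWU => hcond (hssub W hWU (mem_filter.1 hW).2)

lemma sum_blockMatrix_pow (hm : colorCount c true univ = m) (hn : colorCount c false univ = n)
    (k : ℕ) (U : Finset V) (p : Fin (m + 1) × Fin (n + 1)) :
    ∑ W with complCounts c m n W = p, (blockMatrix c ^ k) U W =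
      (transferMatrix m n ^ k) (complCounts c m n U) p := by
  induction k generalizing U with
  | zero =>
    simp only [pow_zero, Matrix.one_apply]
    rw [sum_ite_eq]
    simp
  | succ k ih =>
    simp only [pow_succ', Matrix.mul_apply]
    rw [sum_comm]
    simp only [← mul_sum, ih]
    rw [← sum_fiberwise univ (complCounts c m n)]
    refine sum_congr rfl fun q _ => ?_
    rw [← sum_blockMatrix hm hn, sum_mul]
    refine sum_congr rfl fun X hX => ?_
    rw [(mem_filter.1 hX).2]

lemma signedCount_univ_eq (hm : colorCount c true univ = m) (hn : colorCount c false univ = n) :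
    signedCount c (univ : Finset V) = ∑ k ∈ range (m + n + 1),
      (-1) ^ k * (transferMatrix m n ^ k) (0, 0) (Fin.last m, Fin.last n) := by
  have hcard : Fintype.card V = m + n := by
    rw [← card_univ, ← colorCount_add (c := c), hm, hn]
  rw [signedCount_eq_sum, hcard]
  refine sum_congr rfl fun k _ => ?_
  have huniv : complCounts c m n univ = (0, 0) := by
    rw [complCounts_eq_iff hm hn]
    simp [hm, hn]
  have hempty : ({W | complCounts c m n W = (Fin.last m, Fin.last n)} : Finset (Finset V)) = {∅} := by
    ext W
    rw [mem_filter, complCounts_eq_iff hm hn, mem_singleton, ← card_eq_zero,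
      ← colorCount_add (c := c) W]
    simp
  rw [← huniv, ← sum_blockMatrix_pow hm hn, hempty, sum_singleton]

end Lumping

/-- The colouring of `Fin (m + n)` whose first colour class is the set of the first `m` elements. -/
def sideColor (m n : ℕ) (i : Fin (m + n)) : Bool := decide ((i : ℕ) < m)

lemma colorCount_sideColor_true (m n : ℕ) : colorCount (sideColor m n) true univ = m := by
  simp only [colorCount, sideColor, decide_eq_true_eq]
  rw [Fin.card_filter_val_lt]
  simp

lemma colorCount_sideColor_false (m n : ℕ) : colorCount (sideColor m n) false univ = n := by
  have h := colorCount_add (c := sideColor m n) univ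
  rw [colorCount_sideColor_true, card_univ, Fintype.card_fin] at h
  omega

lemma dA_Kbip (m n : ℕ) (A : Finset (Fin (m + n))) (i : Fin (m + n)) :
    dA (Kbip m n) A i = Kbip m n i.succ 0 + oppCount (sideColor m n) i Aᶜ := by
  rw [dA, oppCount, card_filter]
  congr 1
  refine sum_congr rfl fun j _ => ?_
  simp only [Kbip, sideColor, Fin.val_succ, Fin.ext_iff, Fin.val_zero, ne_eq, decide_eq_decide]
  split_ifs <;> omega

lemma ncard_sPF_Kbip (m n : ℕ) (hm : 1 ≤ m) (hn : 1 ≤ n) :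
    (sPF (Kbip m n)).ncard = spreadCount (sideColor m n) univ := by
  classical
  have htwo : TwoSided (sideColor m n) univ := by
    rw [twoSided_iff_colorCount_pos, colorCount_sideColor_true, colorCount_sideColor_false]
    exact ⟨hm, hn⟩
  have himage : sPF (Kbip m n) = (fun (Q : Fin (m + n) → ℕ) i => Kbip m n i.succ 0 + Q i) ''
      ({Q ∈ boundedFuns univ | Spreads (sideColor m n) univ Q} : Finset (Fin (m + n) → ℕ)) := by
    ext P
    simp only [sPF, Set.mem_ofPred_eq, Set.mem_image, coe_filter, mem_boundedFuns, dA_Kbip,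
      compl_univ]
    have hzero : ∀ i, oppCount (sideColor m n) i ∅ = 0 := fun i => by simp [oppCount]
    simp only [hzero, add_zero]
    constructor
    · rintro ⟨h1, h2⟩
      have hs : Spreads (sideColor m n) univ (fun i => P i - Kbip m n i.succ 0) := by
        intro A _ hne hA
        obtain ⟨i, hi, hlt⟩ := h2 A hne hA
        refine ⟨i, hi, ?_⟩
        rw [← compl_eq_univ_sdiff]
        have := h1 i
        dsimp only
        omega
      refine ⟨fun i => P i - Kbip m n i.succ 0, ⟨⟨fun i _ => ?_, by simp⟩, hs⟩, ?_⟩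
      · have hI : Ignites (sideColor m n) univ (fun i => P i - Kbip m n i.succ 0) univ :=
          ⟨subset_rfl, htwo, hs, by simp⟩
        exact (hI.lt_oppCount (mem_univ i)).trans_le (oppCount_le_card _ _)
      · ext i
        have := h1 i
        dsimp only
        omega
    · rintro ⟨Q, ⟨-, hQ⟩, rfl⟩
      refine ⟨fun i => by simp, fun A hne hA => ?_⟩
      obtain ⟨i, hi, hlt⟩ := hQ A (subset_univ _) hne hA
      rw [← compl_eq_univ_sdiff] at hlt
      exact ⟨i, hi, by simpa using hlt⟩
  rw [himage, Set.ncard_image_of_injective, Set.ncard_coe_finset, spreadCount]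
  intro Q Q' h
  ext i
  simpa using congrFun h i

/-- The signed-sum formula for the number of spherical `K_{m+1,n}`-parking functions.
A pair `(s,t) ∈ Γ_i` is encoded as a pair of tuples `s, t` on `Fin (i+1)` (the index `0`
playing the role of `s_0 = t_0 = 0`), weakly increasing, with `s_i = m`, `t_i = n` and
`s_{j−1} + t_{j−1} < s_j + t_j` for `1 ≤ j ≤ i`. -/
theorem stmt6 (m n : ℕ) (hm : 1 ≤ m) (hn : 1 ≤ n) :
    ((sPF (Kbip m n)).ncard : ℤ) =
      ∑ i ∈ Finset.Icc 1 (m + n), (-1 : ℤ) ^ (m + n - i) *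
        ∑ st : (Fin (i + 1) → Fin (m + 1)) × (Fin (i + 1) → Fin (n + 1)),
          if ((st.1 0 : ℕ) = 0 ∧ (st.2 0 : ℕ) = 0 ∧
              (∀ j : Fin i, (st.1 j.castSucc : ℕ) ≤ (st.1 j.succ : ℕ)) ∧
              (∀ j : Fin i, (st.2 j.castSucc : ℕ) ≤ (st.2 j.succ : ℕ)) ∧
              (st.1 (Fin.last i) : ℕ) = m ∧ (st.2 (Fin.last i) : ℕ) = n ∧
              ∀ j : Fin i, (st.1 j.castSucc : ℕ) + (st.2 j.castSucc : ℕ) <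
                (st.1 j.succ : ℕ) + (st.2 j.succ : ℕ))
          then ((Nat.factorial m /
                  ∏ j : Fin i, Nat.factorial ((st.1 j.succ : ℕ) - (st.1 j.castSucc : ℕ))) *
                (Nat.factorial n /
                  ∏ j : Fin i, Nat.factorial ((st.2 j.succ : ℕ) - (st.2 j.castSucc : ℕ))) *
                ∏ j : Fin i,
                  (if (st.1 j.succ : ℕ) < m ∧ (st.2 j.succ : ℕ) < n then
                    (n - (st.2 j.succ : ℕ)) ^ ((st.1 j.succ : ℕ) - (st.1 j.castSucc : ℕ)) *
                    (m - (st.1 j.succ : ℕ)) ^ ((st.2 j.succ : ℕ) - (st.2 j.castSucc : ℕ))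
                  else 1) : ℤ)
          else 0 := by
  simp only [← transferMatrix_pow_apply]
  have hm' := colorCount_sideColor_true m n
  have hn' := colorCount_sideColor_false m n
  have htwo : TwoSided (sideColor m n) univ := by
    rw [twoSided_iff_colorCount_pos, hm', hn']
    exact ⟨hm, hn⟩
  have h := signedCount_univ_eq hm' hn'
  rw [signedCount, if_pos htwo, ← ncard_sPF_Kbip m n hm hn, card_univ, Fintype.card_fin,
    sum_range_succ', pow_zero (transferMatrix m n), Matrix.one_apply_ne (by
      rw [Ne, Prod.ext_iff, Fin.ext_iff]
      simp only [Fin.val_zero, Fin.val_last]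
      omega), mul_zero, add_zero] at h
  have hsq : ∀ k : ℕ, (-1 : ℤ) ^ k * (-1) ^ k = 1 := fun k => by
    rw [← mul_pow]
    simp
  calc ((sPF (Kbip m n)).ncard : ℤ)
      = (-1) ^ (m + n) * ((-1) ^ (m + n) * ((sPF (Kbip m n)).ncard : ℤ)) := by
        rw [← mul_assoc, hsq, one_mul]
    _ = _ := by
        rw [h, mul_sum, ← Ico_add_one_right_eq_Icc, sum_Ico_eq_sum_range, Nat.add_sub_cancel]
        refine sum_congr rfl fun k hk => ?_
        rw [mem_range] at hk
        rw [add_comm 1 k, ← mul_assoc]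
        congr 1
        nth_rewrite 1 [show m + n = (m + n - (k + 1)) + (k + 1) by omega]
        rw [pow_add, mul_assoc, hsq, mul_one]
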